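/- Let k ≥ 1 be an integer and θ ∈ (−1, 0]. If θ ≥ −1/k, then the system u = k·f_θ(v), v = k·f_θ(u) has the unique solution (u,v) = (0,0). If θ < −1/k, then this system has exactly three solutions: (0,0), (u₀, −u₀) and (−u₀, u₀), where u₀ > 0 is the unique positive solution of u = k·f_{−θ}(u). -/

import Mathlib

/-- Inverse hyperbolic tangent. -/
noncomputable def artanh (x : ℝ) : ℝ := (1 / 2) * Real.log ((1 + x) / (1 - x))

/-- The function `f_θ(h) = arctanh(θ · tanh h)`. -/
noncomputable def isingF (θ h : ℝ) : ℝ := artanh (θ * Real.tanh h)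

lemma cs_pos (t : ℝ) (h0 : 0 ≤ t) (h1 : t < 1) (x : ℝ) :
    0 < Real.cosh x + t * Real.sinh x ∧ 0 < Real.cosh x - t * Real.sinh x := by
  have a : 0 < Real.cosh x + Real.sinh x := by rw [Real.cosh_add_sinh]; positivity
  have b : 0 < Real.cosh x - Real.sinh x := by rw [Real.cosh_sub_sinh]; positivity
  have c := Real.cosh_pos x
  constructor <;> nlinarith

lemma isingF_eq (t : ℝ) (h0 : 0 ≤ t) (h1 : t < 1) (x : ℝ) :
    isingF t x = 1 / 2 * (Real.log (Real.cosh x + t * Real.sinh x)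
      - Real.log (Real.cosh x - t * Real.sinh x)) := by
  obtain ⟨a, b⟩ := cs_pos t h0 h1 x
  have c := Real.cosh_pos x
  rw [← Real.log_div a.ne' b.ne', isingF, artanh, Real.tanh_eq_sinh_div_cosh]
  congr 2
  have : 1 - t * (Real.sinh x / Real.cosh x) = (Real.cosh x - t * Real.sinh x) / Real.cosh x := by
    field_simp
  have h' : 1 + t * (Real.sinh x / Real.cosh x) = (Real.cosh x + t * Real.sinh x) / Real.cosh x := by
    field_simp
  rw [this, h']
  field_simp

lemma isingF_neg (t : ℝ) (h0 : 0 ≤ t) (h1 : t < 1) (x : ℝ) :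
    isingF (-t) x = - isingF t x := by
  have : isingF (-t) x = isingF t (-x) := by simp [isingF, Real.tanh_neg]
  rw [this, isingF_eq t h0 h1, isingF_eq t h0 h1, Real.cosh_neg, Real.sinh_neg]
  ring_nf

lemma isingF_odd (t : ℝ) (h0 : 0 ≤ t) (h1 : t < 1) (x : ℝ) :
    isingF t (-x) = - isingF t x := by
  rw [← isingF_neg t h0 h1]; simp [isingF, Real.tanh_neg]

lemma isingF_zero (t : ℝ) : isingF t 0 = 0 := by simp [isingF, artanh]

lemma den_pos (t : ℝ) (h0 : 0 ≤ t) (h1 : t < 1) (x : ℝ) :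
    0 < 1 + (1 - t ^ 2) * Real.sinh x ^ 2 := by
  have : 0 ≤ 1 - t ^ 2 := by nlinarith
  positivity

lemma isingF_deriv (t : ℝ) (h0 : 0 ≤ t) (h1 : t < 1) (x : ℝ) :
    HasDerivAt (isingF t) (t / (1 + (1 - t ^ 2) * Real.sinh x ^ 2)) x := by
  obtain ⟨a, b⟩ := cs_pos t h0 h1 x
  rw [show isingF t = _ from funext (isingF_eq t h0 h1)]
  have h := ((((Real.hasDerivAt_cosh x).add ((Real.hasDerivAt_sinh x).const_mul t)).log a.ne').sub
    (((Real.hasDerivAt_cosh x).sub ((Real.hasDerivAt_sinh x).const_mul t)).log b.ne')).const_mul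
      (1 / 2 : ℝ)
  refine h.congr_deriv ?_
  have d := den_pos t h0 h1 x
  have e := Real.cosh_sq x
  have key : 1 + (1 - t ^ 2) * Real.sinh x ^ 2
      = (Real.cosh x + t * Real.sinh x) * (Real.cosh x - t * Real.sinh x) := by
    linear_combination -e
  simp only [Pi.add_apply, Pi.sub_apply]
  rw [key, div_sub_div _ _ a.ne' b.ne', ← mul_div_assoc]
  congr 1
  linear_combination t * e

lemma isingF_mono (t : ℝ) (h0 : 0 ≤ t) (h1 : t < 1) : Monotone (isingF t) := by
  apply monotone_of_deriv_nonneg (fun x => (isingF_deriv t h0 h1 x).differentiableAt)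
  intro x
  rw [(isingF_deriv t h0 h1 x).deriv]
  exact div_nonneg h0 (den_pos t h0 h1 x).le

lemma isingF_bdd (t : ℝ) (h0 : 0 ≤ t) (h1 : t < 1) (x : ℝ) :
    isingF t x ≤ 1 / 2 * Real.log ((1 + t) / (1 - t)) := by
  obtain ⟨a, b⟩ := cs_pos t h0 h1 x
  rw [isingF_eq t h0 h1, ← Real.log_div a.ne' b.ne']
  have : (Real.cosh x + t * Real.sinh x) / (Real.cosh x - t * Real.sinh x) ≤ (1 + t) / (1 - t) := by
    rw [div_le_div_iff₀ b (by linarith)]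
    have := Real.sinh_lt_cosh x
    nlinarith
  have := Real.log_le_log (by positivity) this
  linarith

lemma F_deriv (k t : ℝ) (h0 : 0 ≤ t) (h1 : t < 1) (x : ℝ) :
    HasDerivAt (fun x => x - k * isingF t x)
      (1 - k * (t / (1 + (1 - t ^ 2) * Real.sinh x ^ 2))) x :=
  (hasDerivAt_id x).sub ((isingF_deriv t h0 h1 x).const_mul k)

lemma F_pos (k t : ℝ) (hk : 1 ≤ k) (h0 : 0 ≤ t) (h1 : t < 1) (hkt : k * t ≤ 1) (x : ℝ)
    (hx : 0 < x) : 0 < x - k * isingF t x := by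
  have hm : StrictMonoOn (fun x => x - k * isingF t x) (Set.Ici 0) := by
    apply strictMonoOn_of_deriv_pos (convex_Ici 0)
    · exact fun y _ => (F_deriv k t h0 h1 y).continuousAt.continuousWithinAt
    · intro y hy
      rw [interior_Ici, Set.mem_Ioi] at hy
      rw [(F_deriv k t h0 h1 y).deriv, sub_pos, ← mul_div_assoc, div_lt_one (den_pos t h0 h1 y)]
      have : 0 < Real.sinh y := Real.sinh_pos_iff.2 hy
      have : 0 < 1 - t ^ 2 := by nlinarith
      have : 0 < (1 - t ^ 2) * Real.sinh y ^ 2 := by positivity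
      linarith
  have := hm (Set.mem_Ici.2 le_rfl) (Set.mem_Ici.2 hx.le) hx
  simpa [isingF_zero] using this

lemma F_convex (k t : ℝ) (hk : 1 ≤ k) (h0 : 0 < t) (h1 : t < 1) :
    StrictConvexOn ℝ (Set.Ici 0) (fun x => x - k * isingF t x) := by
  apply StrictMonoOn.strictConvexOn_of_deriv (convex_Ici 0)
  · exact fun y _ => (F_deriv k t h0.le h1 y).continuousAt.continuousWithinAt
  · rw [interior_Ici]
    intro x hx y hy hxy
    rw [(F_deriv k t h0.le h1 y).deriv, (F_deriv k t h0.le h1 x).deriv]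
    have a : 0 < Real.sinh x := Real.sinh_pos_iff.2 hx
    have b : Real.sinh x < Real.sinh y := Real.sinh_lt_sinh.2 hxy
    have c : 0 < 1 - t ^ 2 := by nlinarith
    have := den_pos t h0.le h1 x
    gcongr

lemma F_unique (k t : ℝ) (hk : 1 ≤ k) (h0 : 0 < t) (h1 : t < 1) (a b : ℝ) (ha : 0 < a)
    (hab : a < b) (h2 : a = k * isingF t a) (h3 : b = k * isingF t b) : False := by
  have := (F_convex k t hk h0 h1).2 (Set.mem_Ici.2 le_rfl) (Set.mem_Ici.2 (ha.trans hab).le)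
    (ha.trans hab).ne
    (show 0 < 1 - a / b by rw [sub_pos, div_lt_one (by linarith)]; exact hab)
    (show 0 < a / b from div_pos ha (by linarith)) (by ring)
  have e : (1 - a / b) • (0 : ℝ) + (a / b) • b = a := by
    have : b ≠ 0 := by linarith
    simp only [smul_eq_mul]; field_simp; ring
  rw [e] at this
  simp only [smul_eq_mul, isingF_zero, ← h2, ← h3] at this
  simp at this

lemma F_exists (k t : ℝ) (hk : 1 ≤ k) (h0 : 0 < t) (h1 : t < 1) (hkt : 1 < k * t) :
    ∃ u, 0 < u ∧ u = k * isingF t u := by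
  have hd := (F_deriv k t h0.le h1 0).tendsto_slope_zero_right
  have hneg : 1 - k * (t / (1 + (1 - t ^ 2) * Real.sinh 0 ^ 2)) < 0 := by simp; linarith
  obtain ⟨x, hx, hx0⟩ := ((hd.eventually (gt_mem_nhds hneg)).and self_mem_nhdsWithin).exists
  simp only [zero_add, isingF_zero, mul_zero, sub_zero, smul_eq_mul] at hx
  have hx' : x - k * isingF t x < 0 := by
    by_contra h
    push Not at h
    have := mul_nonneg (inv_nonneg.2 hx0.le) h
    linarith
  set M := k * (1 / 2 * Real.log ((1 + t) / (1 - t))) with hM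
  have hb : ∀ y, k * isingF t y ≤ M := fun y =>
    mul_le_mul_of_nonneg_left (isingF_bdd t h0.le h1 y) (by linarith)
  have hxM : x ≤ M := by linarith [hb x]
  have hc : ContinuousOn (fun x => x - k * isingF t x) (Set.Icc x M) :=
    fun y _ => (F_deriv k t h0.le h1 y).continuousAt.continuousWithinAt
  obtain ⟨u, hu, hu0⟩ := intermediate_value_Icc hxM hc
    (show (0 : ℝ) ∈ Set.Icc _ _ from ⟨hx'.le, by linarith [hb M]⟩)
  exact ⟨u, lt_of_lt_of_le hx0 hu.1, by simp only at hu0; linarith⟩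

lemma system_iff (k t : ℝ) (hk : 1 ≤ k) (h0 : 0 ≤ t) (h1 : t < 1) (u v : ℝ) :
    (u = k * isingF (-t) v ∧ v = k * isingF (-t) u) ↔ (v = -u ∧ u = k * isingF t u) := by
  rw [isingF_neg t h0 h1, isingF_neg t h0 h1]
  constructor
  · rintro ⟨a, b⟩
    have hv : v = -u := by
      have o := isingF_odd t h0 h1 v
      rcases lt_trichotomy (-v) u with h | h | h
      · have := isingF_mono t h0 h1 h.le
        nlinarith
      · linarith
      · have := isingF_mono t h0 h1 h.le
        nlinarith
    exact ⟨hv, by linarith⟩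
  · rintro ⟨rfl, h⟩
    rw [isingF_odd t h0 h1]
    constructor <;> linarith

/-- Antiferromagnetic case `θ ∈ (−1, 0]`: the system `u = k f_θ(v)`, `v = k f_θ(u)` has
the unique solution `(0,0)` if `θ ≥ −1/k`, and exactly the three solutions `(0,0)`,
`(u₀, −u₀)`, `(−u₀, u₀)` if `θ < −1/k`, with `u₀ > 0` the unique positive solution of
`u = k f_{−θ}(u)`. -/
theorem antiferro_system_solutions (k : ℕ) (hk : 1 ≤ k)
    (θ : ℝ) (hθ : θ ∈ Set.Ioc (-1 : ℝ) 0) :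
    (θ ≥ -(1 / (k : ℝ)) →
      ∀ u v : ℝ,
        (u = (k : ℝ) * isingF θ v ∧ v = (k : ℝ) * isingF θ u) ↔ (u = 0 ∧ v = 0)) ∧
    (θ < -(1 / (k : ℝ)) →
      ∃ u₀ : ℝ, 0 < u₀ ∧ u₀ = (k : ℝ) * isingF (-θ) u₀ ∧
        (∀ u : ℝ, 0 < u → u = (k : ℝ) * isingF (-θ) u → u = u₀) ∧
        ∀ u v : ℝ,
          (u = (k : ℝ) * isingF θ v ∧ v = (k : ℝ) * isingF θ u) ↔
          ((u, v) = ((0 : ℝ), (0 : ℝ)) ∨ (u, v) = (u₀, -u₀) ∨ (u, v) = (-u₀, u₀))) := by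
  obtain ⟨t, rfl⟩ : ∃ t, θ = -t := ⟨-θ, by ring⟩
  obtain ⟨ht1, ht0⟩ := hθ
  have h0 : 0 ≤ t := by linarith
  have h1 : t < 1 := by linarith
  have hk' : (1 : ℝ) ≤ k := by exact_mod_cast hk
  have hkp : (0 : ℝ) < k := by linarith
  constructor
  · intro h u v
    have hkt : (k : ℝ) * t ≤ 1 := by
      have : t ≤ 1 / k := by linarith
      rw [le_div_iff₀ hkp] at this
      linarith
    rw [system_iff k t hk' h0 h1]
    constructor
    · rintro ⟨rfl, h⟩
      have : u = 0 := by
        rcases lt_trichotomy u 0 with hu | hu | hu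
        · have := F_pos k t hk' h0 h1 hkt (-u) (by linarith)
          rw [isingF_odd t h0 h1] at this
          linarith
        · exact hu
        · have := F_pos k t hk' h0 h1 hkt u hu
          linarith
      subst this
      simp
    · rintro ⟨rfl, rfl⟩
      simp [isingF_zero]
  · intro h
    have hkt : 1 < (k : ℝ) * t := by
      have : 1 / k < t := by linarith
      rw [div_lt_iff₀ hkp] at this
      linarith
    have h0' : 0 < t := by
      rcases h0.lt_or_eq with h | h
      · exact h
      · rw [← h] at hkt; linarith
    rw [neg_neg]
    obtain ⟨w, hw, hww⟩ := F_exists k t hk' h0' h1 hkt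
    have huniq : ∀ u : ℝ, 0 < u → u = k * isingF t u → u = w := by
      intro u hu huu
      rcases lt_trichotomy u w with h | h | h
      · exact (F_unique k t hk' h0' h1 u w hu h huu hww).elim
      · exact h
      · exact (F_unique k t hk' h0' h1 w u hw h hww huu).elim
    refine ⟨w, hw, hww, huniq, ?_⟩
    intro u v
    rw [system_iff k t hk' h0 h1]
    simp only [Prod.mk.injEq]
    constructor
    · rintro ⟨rfl, h⟩
      rcases lt_trichotomy u 0 with hu | hu | hu
      · have := huniq (-u) (by linarith) (by rw [isingF_odd t h0 h1]; linarith)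
        right; right
        constructor <;> linarith
      · left; subst hu; simp
      · right; left
        have := huniq u hu h
        subst this
        simp
    · rintro (⟨rfl, rfl⟩ | ⟨rfl, rfl⟩ | ⟨rfl, rfl⟩)
      · simp [isingF_zero]
      · exact ⟨rfl, hww⟩
      · exact ⟨by ring, by rw [isingF_odd t h0 h1]; linarith⟩
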